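/- There exists a constant C, depending only on d and C₀, such that for every measurable f ≥ 0 on X and every x ∈ X one has ∫_X |K'(x,y)| f(y) dμ(y) ≤ C · M_{μ,3} f(x). -/

import Mathlib

open MeasureTheory Metric Set
open scoped ENNReal Classical

noncomputable section

/-- The half-open axis-parallel square with center `c` and side length `L`,
i.e. `[c.re - L/2, c.re + L/2) × [c.im - L/2, c.im + L/2)` in `ℝ² = ℂ`. -/
def square (c : ℂ) (L : ℝ) : Set ℂ :=
  {w : ℂ | w.re ∈ Set.Ico (c.re - L / 2) (c.re + L / 2) ∧
    w.im ∈ Set.Ico (c.im - L / 2) (c.im + L / 2)}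

/-- `c` is the center of a dyadic square of side length `2 ^ k`,
i.e. of `2 ^ k • ([0,1)² + z)` for some `z ∈ ℤ²`. -/
def IsDyadicCenter (c : ℂ) (k : ℤ) : Prop :=
  ∃ a b : ℤ, c.re = 2 ^ k * ((a : ℝ) + 1 / 2) ∧ c.im = 2 ^ k * ((b : ℝ) + 1 / 2)

/-- The modified maximal operator
`M_{ν,3} f(x) := sup_{R>0} (1/ν(B(x,3R))) ∫_{B(x,R)} |f| dν`,
with the convention that a term is `0` when `ν(B(x,3R)) = ∞`
(in `ℝ≥0∞` one has `∞⁻¹ = 0` and `0 * ∞ = 0`). -/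
def maxOp {Y : Type*} [PseudoMetricSpace Y] [MeasurableSpace Y] (ν : Measure Y)
    (f : Y → ℝ) (x : Y) : ℝ≥0∞ :=
  ⨆ (R : ℝ) (_ : 0 < R),
    (ν (ball x (3 * R)))⁻¹ * ∫⁻ y in ball x R, (‖f y‖₊ : ℝ≥0∞) ∂ν

theorem measurableSet_square (c : ℂ) (L : ℝ) : MeasurableSet (square c L) :=
  (Complex.measurable_re measurableSet_Ico).inter (Complex.measurable_im measurableSet_Ico)

theorem volume_square (c : ℂ) (L : ℝ) :
    volume (square c L) = ENNReal.ofReal L * ENNReal.ofReal L := by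
  have h : square c L = Complex.measurableEquivRealProd ⁻¹'
      (Ico (c.re - L / 2) (c.re + L / 2) ×ˢ Ico (c.im - L / 2) (c.im + L / 2)) := by
    ext w
    simp [square]
  rw [h, Complex.volume_preserving_equiv_real_prod.measure_preimage
    (measurableSet_Ico.prod measurableSet_Ico).nullMeasurableSet, Measure.volume_eq_prod,
    Measure.prod_prod, Real.volume_Ico, Real.volume_Ico]
  ring_nf

theorem square_subset_square (c : ℂ) {L L' : ℝ} (h : L ≤ L') : square c L ⊆ square c L' := by
  rintro w ⟨⟨h1, h2⟩, h3, h4⟩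
  exact ⟨⟨by linarith, by linarith⟩, by linarith, by linarith⟩

/-- The center of the dyadic square `2 ^ j • ([0,1)² + (p, q))`. -/
def dyadicCenter (j p q : ℤ) : ℂ := ⟨2 ^ j * ((p : ℝ) + 1 / 2), 2 ^ j * ((q : ℝ) + 1 / 2)⟩

theorem isDyadicCenter_dyadicCenter (j p q : ℤ) : IsDyadicCenter (dyadicCenter j p q) j :=
  ⟨p, q, rfl, rfl⟩

theorem IsDyadicCenter.exists_eq {c : ℂ} {k : ℤ} (h : IsDyadicCenter c k) :
    ∃ a b : ℤ, c = dyadicCenter k a b := by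
  obtain ⟨a, b, h1, h2⟩ := h
  exact ⟨a, b, Complex.ext h1 h2⟩

theorem mem_Ico_dyadic_iff (w : ℝ) (j p : ℤ) :
    w ∈ Ico ((2 : ℝ) ^ j * ((p : ℝ) + 1 / 2) - 2 ^ j / 2) (2 ^ j * ((p : ℝ) + 1 / 2) + 2 ^ j / 2) ↔
      ⌊w / 2 ^ j⌋ = p := by
  have hj : (0 : ℝ) < 2 ^ j := by positivity
  rw [Int.floor_eq_iff, le_div_iff₀ hj, div_lt_iff₀ hj, mem_Ico]
  constructor <;> rintro ⟨h1, h2⟩ <;> constructor <;> linarith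

theorem mem_square_dyadicCenter_iff (w : ℂ) (j p q : ℤ) :
    w ∈ square (dyadicCenter j p q) (2 ^ j) ↔ ⌊w.re / 2 ^ j⌋ = p ∧ ⌊w.im / 2 ^ j⌋ = q :=
  and_congr (mem_Ico_dyadic_iff _ _ _) (mem_Ico_dyadic_iff _ _ _)

theorem floor_div_two_zpow (w : ℝ) {k j : ℤ} (hkj : k ≤ j) :
    ⌊w / 2 ^ j⌋ = ⌊w / 2 ^ k⌋ / (2 ^ (j - k).toNat : ℕ) := by
  obtain ⟨n, rfl⟩ := Int.le.dest hkj
  rw [← Int.floor_div_natCast, zpow_add₀ two_ne_zero, ← div_div]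
  simp

/-- A dyadic square is contained in the dyadic square of a larger generation which contains any
one of its points. -/
theorem square_subset_square_dyadicCenter {c w : ℂ} {k j : ℤ} (hc : IsDyadicCenter c k)
    (hkj : k ≤ j) (hw : w ∈ square c (2 ^ k)) :
    square c (2 ^ k) ⊆ square (dyadicCenter j ⌊w.re / 2 ^ j⌋ ⌊w.im / 2 ^ j⌋) (2 ^ j) := by
  obtain ⟨a, b, rfl⟩ := hc.exists_eq
  intro u hu
  rw [mem_square_dyadicCenter_iff] at hu hw ⊢
  simp only [floor_div_two_zpow _ hkj, hu, hw, and_self]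

theorem floor_div_sub_floor_div_mem {u x r : ℝ} (hr : 0 < r) (h : |u - x| < r) :
    ⌊u / r⌋ - ⌊x / r⌋ ∈ Finset.Icc (-1 : ℤ) 1 := by
  obtain ⟨h1, h2⟩ := abs_lt.1 h
  have h3 : u / r < x / r + 1 := by rw [div_add_one hr.ne']; gcongr; linarith
  have h4 : x / r < u / r + 1 := by rw [div_add_one hr.ne']; gcongr; linarith
  have h5 := Int.floor_mono h3.le
  have h6 := Int.floor_mono h4.le
  rw [Int.floor_add_one] at h5 h6
  rw [Finset.mem_Icc]
  constructor <;> omega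

/-- A point at distance less than `L` from a point of `square c L` lies in `square c (4 * L)`. -/
theorem mem_square_four_mul {c u x : ℂ} {L : ℝ} (hu : u ∈ square c L) (hx : ‖u - x‖ < L) :
    x ∈ square c (4 * L) := by
  obtain ⟨h1, h2⟩ := abs_lt.1 ((Complex.abs_re_le_norm _).trans_lt hx)
  obtain ⟨h3, h4⟩ := abs_lt.1 ((Complex.abs_im_le_norm _).trans_lt hx)
  rw [Complex.sub_re] at h1 h2
  rw [Complex.sub_im] at h3 h4
  obtain ⟨⟨h5, h6⟩, h7, h8⟩ := hu
  exact ⟨⟨by linarith, by linarith⟩, by linarith, by linarith⟩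

section Packing

variable {d C₀ : ℝ} {M : ℕ} {c : Fin M → ℂ} {k : Fin M → ℤ}

/-- The weighted measure `∑ ℓ(Q_m)^{-d} · m₂|_{Q_m}`. -/
def weightedMeasure (d : ℝ) (c : Fin M → ℂ) (k : Fin M → ℤ) : Measure ℂ :=
  ∑ m, ENNReal.ofReal (((2 : ℝ) ^ (k m)) ^ (-d)) • volume.restrict (square (c m) (2 ^ (k m)))

theorem ae_mem_iUnion_square :
    ∀ᵐ y ∂(weightedMeasure d c k), y ∈ ⋃ m, square (c m) (2 ^ (k m)) := by
  rw [ae_iff, weightedMeasure, Measure.finsetSum_apply]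
  refine Finset.sum_eq_zero fun m _ => ?_
  have h : volume.restrict (square (c m) (2 ^ (k m)))
      {y | y ∉ ⋃ m, square (c m) (2 ^ (k m))} = 0 := by
    rw [← ae_iff]
    filter_upwards [ae_restrict_mem (measurableSet_square _ _)] with y hy
    exact mem_iUnion.2 ⟨m, hy⟩
  rw [Measure.smul_apply, h, smul_zero]

theorem weightedMeasure_le (s : Set ℂ) (hs : MeasurableSet s) :
    weightedMeasure d c k s ≤ ENNReal.ofReal
      (∑ m, if (s ∩ square (c m) (2 ^ (k m))).Nonempty then ((2 : ℝ) ^ (k m)) ^ (2 - d) else 0) := by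
  rw [weightedMeasure, Measure.finsetSum_apply, ENNReal.ofReal_sum_of_nonneg
    fun m _ => by split_ifs <;> positivity]
  refine Finset.sum_le_sum fun m _ => ?_
  rw [Measure.smul_apply, Measure.restrict_apply hs, smul_eq_mul]
  split_ifs with h
  · have h0 : (0 : ℝ) < 2 ^ (k m) := by positivity
    calc _ ≤ ENNReal.ofReal (((2 : ℝ) ^ (k m)) ^ (-d)) * volume (square (c m) (2 ^ (k m))) := by
          gcongr
          exact inter_subset_right
      _ = _ := by
          rw [volume_square, ← ENNReal.ofReal_mul h0.le, ← ENNReal.ofReal_mul (by positivity),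
            sub_eq_neg_add, Real.rpow_add h0, Real.rpow_two, sq]
  · rw [not_nonempty_iff_eq_empty.1 h]
    simp

/-- Polynomial growth of the weighted measure on balls centered in a square `Q_i` and of radius
at least `ℓ(Q_i)`. -/
theorem weightedMeasure_ball_le (hd : ∀ m, IsDyadicCenter (c m) (k m))
    (hdisj : ∀ m m', m ≠ m' →
      square (c m) (4 * 2 ^ (k m)) ∩ square (c m') (4 * 2 ^ (k m')) = ∅)
    (hpack : ∀ (c₀ : ℂ) (k₀ : ℤ), IsDyadicCenter c₀ k₀ →
      ∑ m, (if square (c m) (2 ^ (k m)) ⊆ square c₀ (2 ^ k₀)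
            then ((2 : ℝ) ^ (k m)) ^ (2 - d) else 0) ≤ C₀ * ((2 : ℝ) ^ k₀) ^ (2 - d))
    {i : Fin M} {x : ℂ} (hx : x ∈ square (c i) (2 ^ (k i))) {j : ℤ} (hj : k i ≤ j) :
    weightedMeasure d c k (ball x (2 ^ j)) ≤
      ENNReal.ofReal (9 * C₀ * ((2 : ℝ) ^ j) ^ (2 - d)) := by
  have hj0 : (0 : ℝ) < 2 ^ j := by positivity
  refine (weightedMeasure_le _ measurableSet_ball).trans (ENNReal.ofReal_le_ofReal ?_)
  set I := Finset.Icc (-1 : ℤ) 1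
  let z : ℤ × ℤ → ℂ := fun p => dyadicCenter j (⌊x.re / 2 ^ j⌋ + p.1) (⌊x.im / 2 ^ j⌋ + p.2)
  calc _ ≤ ∑ m, ∑ p ∈ I ×ˢ I, (if square (c m) (2 ^ (k m)) ⊆ square (z p) (2 ^ j)
            then ((2 : ℝ) ^ (k m)) ^ (2 - d) else 0) := by
        refine Finset.sum_le_sum fun m _ => ?_
        have hnn : ∀ p ∈ I ×ˢ I, 0 ≤ (if square (c m) (2 ^ (k m)) ⊆ square (z p) (2 ^ j)
            then ((2 : ℝ) ^ (k m)) ^ (2 - d) else 0) := fun p _ => by split_ifs <;> positivity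
        split_ifs with h
        · obtain ⟨u, hu, hum⟩ := h
          rw [mem_ball, Complex.dist_eq] at hu
          have hkm : k m ≤ j := by
            by_contra! hlt
            have hle : (2 : ℝ) ^ j ≤ 2 ^ (k m) := zpow_le_zpow_right₀ one_le_two hlt.le
            have hxm := mem_square_four_mul hum (hu.trans_le hle)
            have hmi : m ≠ i := by rintro rfl; omega
            have hxi : x ∈ square (c i) (4 * 2 ^ (k i)) :=
              square_subset_square _ (by linarith [zpow_pos (two_pos : (0 : ℝ) < 2) (k i)]) hx
            exact (hdisj m i hmi).subset ⟨hxm, hxi⟩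
          have hmem : (⌊u.re / 2 ^ j⌋ - ⌊x.re / 2 ^ j⌋, ⌊u.im / 2 ^ j⌋ - ⌊x.im / 2 ^ j⌋) ∈ I ×ˢ I :=
            Finset.mk_mem_product
              (floor_div_sub_floor_div_mem hj0 ((Complex.abs_re_le_norm (u - x)).trans_lt hu))
              (floor_div_sub_floor_div_mem hj0 ((Complex.abs_im_le_norm (u - x)).trans_lt hu))
          refine le_trans (le_of_eq ?_) (Finset.single_le_sum hnn hmem)
          rw [if_pos]
          simpa only [z, add_sub_cancel] using square_subset_square_dyadicCenter (hd m) hkm hum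
        · exact Finset.sum_nonneg hnn
    _ = ∑ p ∈ I ×ˢ I, ∑ m, (if square (c m) (2 ^ (k m)) ⊆ square (z p) (2 ^ j)
            then ((2 : ℝ) ^ (k m)) ^ (2 - d) else 0) := Finset.sum_comm
    _ ≤ ∑ p ∈ I ×ˢ I, C₀ * ((2 : ℝ) ^ j) ^ (2 - d) :=
        Finset.sum_le_sum fun p _ => hpack _ _ (isDyadicCenter_dyadicCenter _ _ _)
    _ = 9 * C₀ * ((2 : ℝ) ^ j) ^ (2 - d) := by
        rw [Finset.sum_const, Finset.card_product, show I.card = 3 from rfl, nsmul_eq_mul]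
        push_cast
        ring

end Packing

theorem setLIntegral_ball_le_mul_maxOp {Y : Type*} [PseudoMetricSpace Y] [MeasurableSpace Y]
    (ν : Measure Y) (f : Y → ℝ) (x : Y) {R : ℝ} (hR : 0 < R) (hfin : ν (ball x (3 * R)) ≠ ∞) :
    ∫⁻ y in ball x R, (‖f y‖₊ : ℝ≥0∞) ∂ν ≤ ν (ball x (3 * R)) * maxOp ν f x := by
  by_cases h0 : ν (ball x (3 * R)) = 0
  · have h : ν (ball x R) = 0 := measure_mono_null (ball_subset_ball (by linarith)) h0
    rw [setLIntegral_measure_zero _ _ h]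
    exact zero_le
  · calc _ = ν (ball x (3 * R)) *
          ((ν (ball x (3 * R)))⁻¹ * ∫⁻ y in ball x R, (‖f y‖₊ : ℝ≥0∞) ∂ν) := by
          rw [← mul_assoc, ENNReal.mul_inv_cancel h0 hfin, one_mul]
      _ ≤ _ := by
          gcongr
          exact le_iSup₂ (f := fun (R : ℝ) (_ : 0 < R) =>
            (ν (ball x (3 * R)))⁻¹ * ∫⁻ y in ball x R, (‖f y‖₊ : ℝ≥0∞) ∂ν) R hR

/-- Dyadic decomposition of the kernel `L ^ d / |x - y| ^ 2` away from the ball `B(x, L)`. -/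
theorem ofReal_kernel_le_tsum_indicator {d L : ℝ} (hL : 0 < L) {x y : ℂ} (hxy : L ≤ ‖y - x‖) :
    ENNReal.ofReal (L ^ d / ‖y - x‖ ^ 2) ≤
      ∑' n : ℕ, (ball x (2 ^ (n + 1) * L)).indicator
        (fun _ => ENNReal.ofReal (L ^ d / (2 ^ n * L) ^ 2)) y := by
  obtain ⟨n, h1, h2⟩ := exists_nat_pow_near ((one_le_div hL).2 hxy) one_lt_two
  rw [le_div_iff₀ hL] at h1
  rw [div_lt_iff₀ hL] at h2
  refine le_trans ?_ (ENNReal.le_tsum n)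
  rw [indicator_of_mem (by rwa [mem_ball, Complex.dist_eq])]
  gcongr

theorem kernel_mul_growth_eq {d L C₀ : ℝ} (hL : 0 < L) (n : ℕ) :
    L ^ d / (2 ^ n * L) ^ 2 * (9 * C₀ * (2 ^ (n + 3) * L) ^ (2 - d)) =
      9 * C₀ * 8 ^ (2 - d) * ((2 : ℝ) ^ (-d)) ^ n := by
  have h1 : (2 : ℝ) ^ (n + 3) * L = 8 * (2 ^ n * L) := by ring
  have h2 : (0 : ℝ) < 2 ^ n * L := by positivity
  have h3 : ((2 : ℝ) ^ (-d)) ^ n = ((2 : ℝ) ^ n) ^ (-d) := by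
    rw [← Real.rpow_natCast, ← Real.rpow_natCast, ← Real.rpow_mul two_pos.le,
      ← Real.rpow_mul two_pos.le, mul_comm]
  rw [h1, Real.mul_rpow (by norm_num) h2.le, sub_eq_add_neg 2 d, Real.rpow_add h2, h3,
    Real.rpow_two, Real.mul_rpow (by positivity) hL.le, Real.rpow_neg hL.le]
  have := Real.rpow_pos_of_pos hL d
  field_simp

/-- the operator with kernel `|K'(x,y)| = |K(y,x)|` applied to a
nonnegative measurable `f` is pointwise dominated on `X` by `C · M_{μ,3} f`. -/
theorem statement4 (d : ℝ) (hd0 : 0 < d) (hd2 : d < 2) (C₀ : ℝ) (hC₀ : 1 ≤ C₀) :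
    ∃ C : ℝ, 0 < C ∧
      ∀ (M : ℕ) (c : Fin M → ℂ) (k : Fin M → ℤ),
        (∀ m, IsDyadicCenter (c m) (k m)) →
        (∀ m m', m ≠ m' →
          square (c m) (4 * 2 ^ (k m)) ∩ square (c m') (4 * 2 ^ (k m')) = ∅) →
        (∀ (c₀ : ℂ) (k₀ : ℤ), IsDyadicCenter c₀ k₀ →
          ∑ m, (if square (c m) (2 ^ (k m)) ⊆ square c₀ (2 ^ k₀)
                then ((2 : ℝ) ^ (k m)) ^ (2 - d) else 0)
            ≤ C₀ * ((2 : ℝ) ^ k₀) ^ (2 - d)) →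
        ∀ (X : Set ℂ), X = ⋃ m, square (c m) (2 ^ (k m)) →
        ∀ (μ : Measure ℂ),
          μ = ∑ m, ENNReal.ofReal (((2 : ℝ) ^ (k m)) ^ (-d)) •
                volume.restrict (square (c m) (2 ^ (k m))) →
        ∀ (K : ℂ → ℂ → ℂ),
          (∀ i : Fin M, ∀ x ∈ square (c i) (2 ^ (k i)),
            ∀ y ∈ square (c i) (2 ^ (k i)), K x y = 0) →
          (∀ i j : Fin M, i ≠ j → ∀ x ∈ square (c j) (2 ^ (k j)),
            ∀ y ∈ square (c i) (2 ^ (k i)),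
            K x y = ((((2 : ℝ) ^ (k i)) ^ d : ℝ) : ℂ) / (x - y) ^ 2) →
        ∀ (f : ℂ → ℝ), Measurable f → (∀ y, 0 ≤ f y) →
        ∀ x ∈ X,
          ∫⁻ y, (‖K y x‖₊ : ℝ≥0∞) * ENNReal.ofReal (f y) ∂μ
            ≤ ENNReal.ofReal C * maxOp μ f x := by
  have hq0 : (0 : ℝ) ≤ 2 ^ (-d) := by positivity
  have hq1 : (2 : ℝ) ^ (-d) < 1 := Real.rpow_lt_one_of_one_lt_of_neg one_lt_two (by linarith)
  have hA : 0 < 9 * C₀ * (8 : ℝ) ^ (2 - d) := by positivity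
  refine ⟨9 * C₀ * 8 ^ (2 - d) * (1 - 2 ^ (-d))⁻¹, mul_pos hA (inv_pos.2 (by linarith)), ?_⟩
  intro M c k hd hdisj hpack X hX μ hμ K hK0 hK f hf hf0 x hx
  change μ = weightedMeasure d c k at hμ
  subst hμ hX
  set μ := weightedMeasure d c k
  obtain ⟨i, hxi⟩ := mem_iUnion.1 hx
  set L : ℝ := 2 ^ (k i) with hL
  have hL0 : 0 < L := by positivity
  have hpow : ∀ n : ℕ, (2 : ℝ) ^ (n + 3) * L = 2 ^ (k i + (n + 3 : ℕ)) := fun n => by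
    rw [hL, zpow_add₀ two_ne_zero, zpow_natCast, mul_comm]
  have hball : ∀ n : ℕ, μ (ball x (3 * (2 ^ (n + 1) * L))) ≤
      ENNReal.ofReal (9 * C₀ * (2 ^ (n + 3) * L) ^ (2 - d)) := fun n => by
    refine (measure_mono (ball_subset_ball ?_)).trans
      ((weightedMeasure_ball_le hd hdisj hpack hxi
        (j := k i + (n + 3 : ℕ)) (by omega)).trans_eq (by rw [hpow]))
    rw [← hpow, pow_add, pow_add]
    have : (0 : ℝ) < 2 ^ n * L := by positivity
    linarith
  have hker : ∀ᵐ y ∂μ, (‖K y x‖₊ : ℝ≥0∞) ≤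
      ∑' n : ℕ, (ball x (2 ^ (n + 1) * L)).indicator
        (fun _ => ENNReal.ofReal (L ^ d / (2 ^ n * L) ^ 2)) y := by
    filter_upwards [ae_mem_iUnion_square] with y hy
    obtain ⟨m, hym⟩ := mem_iUnion.1 hy
    by_cases hmi : i = m
    · subst hmi
      simp [hK0 i y hym x hxi]
    · have hyx : L ≤ ‖y - x‖ := by
        by_contra! hlt
        rw [norm_sub_rev] at hlt
        refine (hdisj i m hmi).subset ⟨mem_square_four_mul hxi hlt, square_subset_square _ ?_ hym⟩
        linarith [zpow_pos (two_pos : (0 : ℝ) < 2) (k m)]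
      refine le_trans (le_of_eq ?_) (ofReal_kernel_le_tsum_indicator hL0 hyx)
      rw [hK i m hmi y hym x hxi, ← enorm_eq_nnnorm, ← ofReal_norm, norm_div, norm_pow,
        Complex.norm_of_nonneg (by positivity)]
  calc ∫⁻ y, (‖K y x‖₊ : ℝ≥0∞) * ENNReal.ofReal (f y) ∂μ
      ≤ ∫⁻ y, ∑' n : ℕ, (ball x (2 ^ (n + 1) * L)).indicator
          (fun y => ENNReal.ofReal (L ^ d / (2 ^ n * L) ^ 2) * (‖f y‖₊ : ℝ≥0∞)) y ∂μ := by
        refine lintegral_mono_ae ?_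
        filter_upwards [hker] with y hy
        simp only [indicator_mul_left, ENNReal.tsum_mul_right]
        rw [← enorm_eq_nnnorm (f y), Real.enorm_of_nonneg (hf0 y)]
        gcongr
    _ = ∑' n : ℕ, ENNReal.ofReal (L ^ d / (2 ^ n * L) ^ 2) *
          ∫⁻ y in ball x (2 ^ (n + 1) * L), (‖f y‖₊ : ℝ≥0∞) ∂μ := by
        rw [lintegral_tsum fun n =>
          ((hf.nnnorm.coe_nnreal_ennreal.const_mul _).indicator measurableSet_ball).aemeasurable]
        refine tsum_congr fun n => ?_
        rw [lintegral_indicator measurableSet_ball,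
          lintegral_const_mul _ hf.nnnorm.coe_nnreal_ennreal]
    _ ≤ ∑' n : ℕ, ENNReal.ofReal (9 * C₀ * 8 ^ (2 - d) * ((2 : ℝ) ^ (-d)) ^ n) * maxOp μ f x := by
        refine ENNReal.tsum_le_tsum fun n => ?_
        rw [← kernel_mul_growth_eq hL0, ENNReal.ofReal_mul (by positivity), mul_assoc]
        gcongr
        refine (setLIntegral_ball_le_mul_maxOp μ f x (by positivity)
          ((hball n).trans_lt ENNReal.ofReal_lt_top).ne).trans ?_
        gcongr
        exact hball n
    _ = _ := by
        rw [ENNReal.tsum_mul_right, ← ENNReal.ofReal_tsum_of_nonneg (fun n => by positivity)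
          ((summable_geometric_of_lt_one hq0 hq1).mul_left _), tsum_mul_left,
          tsum_geometric_of_lt_one hq0 hq1]
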